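/- Let n = 2, ℓ = 2d−2, assume F is nondegenerate, let m ≥ 0 be an integer with d(m+1) ≠ 0 in K, let v ∈ ℤ³ have degree dm + ℓ, and let i ∈ {0,1,2} be such that v_i + 1 ≠ 0 in K. Then the restriction map ℰ_{v+e_i,ℓ+1} → ℰ_{v,ℓ}, G̃ ↦ G̃|_{D(v,ℓ)}, is a K-linear isomorphism; in particular, for each G ∈ ℰ_{v,ℓ} there is a unique G̃ ∈ ℰ_{v+e_i,ℓ+1} with G̃|_{D(v,ℓ)} = G. -/

import Mathlib

noncomputable section

open MvPolynomial

/-- The finset `D_ℓ` of exponent vectors in `ℤ_{≥0}^{n+1}` of total degree `ℓ`,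
realized as integer vectors. -/
def Dfin (n ℓ : ℕ) : Finset (Fin (n + 1) → ℤ) :=
  (Finset.Nat.antidiagonalTuple (n + 1) ℓ).image fun t i => (t i : ℤ)

/-- The inverted simplex `D(v,ℓ) = {v - w : w ∈ D_ℓ}`. -/
def Dv {n : ℕ} (v : Fin (n + 1) → ℤ) (ℓ : ℕ) : Finset (Fin (n + 1) → ℤ) :=
  (Dfin n ℓ).image fun w => v - w

/-- The coefficient of a polynomial at an integer exponent vector (zero if some exponent
is negative). -/
def coeffZ {K : Type*} [Field K] {n : ℕ} (F : MvPolynomial (Fin (n + 1)) K)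
    (u : Fin (n + 1) → ℤ) : K :=
  if ∀ i, 0 ≤ u i then
    MvPolynomial.coeff (Finsupp.equivFunOnFinite.symm fun i => (u i).toNat) F
  else 0

/-- The linear functional
`G ↦ Σ_{t ∈ D_d} ((v_i - s_i) - (m+1)·t_i) · F_t · G_{v-s-t}`, i.e. the difference of the
two sides of the defining equation of `ℰ_{v,ℓ}` at `(s,i)`. -/
def eqFun {K : Type*} [Field K] {n : ℕ} (F : MvPolynomial (Fin (n + 1)) K) (d m : ℕ)
    (v s : Fin (n + 1) → ℤ) (i : Fin (n + 1)) : ((Fin (n + 1) → ℤ) →₀ K) →ₗ[K] K :=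
  ∑ t ∈ Dfin n d,
    ((((v i - s i : ℤ) : K) - ((m : K) + 1) * ((t i : ℤ) : K)) * coeffZ F t) •
      (Finsupp.lapply (v - s - t) : ((Fin (n + 1) → ℤ) →₀ K) →ₗ[K] K)

/-- The space `ℰ_{v,ℓ}`: Laurent polynomials `G` supported on `D(v,ℓ)` such that for every
`s ∈ D_{ℓ-d}` and every `i ∈ {0,…,n}`,
`(v_i - s_i) Σ_{t∈D_d} F_t G_{v-s-t} = (m+1) Σ_{t∈D_d} t_i F_t G_{v-s-t}`. -/
def Espace {K : Type*} [Field K] {n : ℕ} (F : MvPolynomial (Fin (n + 1)) K) (d m : ℕ)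
    (v : Fin (n + 1) → ℤ) (ℓ : ℕ) : Submodule K ((Fin (n + 1) → ℤ) →₀ K) :=
  Finsupp.supported K K ↑(Dv v ℓ) ⊓
    ⨅ s ∈ Dfin n (ℓ - d), ⨅ i : Fin (n + 1), LinearMap.ker (eqFun F d m v s i)

/-- Restriction `G|_S` of a Laurent polynomial to a finite set of monomials. -/
def restrictF {K : Type*} [Field K] {n : ℕ} (G : (Fin (n + 1) → ℤ) →₀ K)
    (S : Finset (Fin (n + 1) → ℤ)) : (Fin (n + 1) → ℤ) →₀ K :=
  ∑ u ∈ S, Finsupp.single u (G u)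

/-- Restriction `F|_S` of a polynomial to a finite set of (integer) monomials, as a Laurent
polynomial. -/
def restrictPoly {K : Type*} [Field K] {n : ℕ} (F : MvPolynomial (Fin (n + 1)) K)
    (S : Finset (Fin (n + 1) → ℤ)) : (Fin (n + 1) → ℤ) →₀ K :=
  ∑ u ∈ S, Finsupp.single u (coeffZ F u)

/-- The coefficient of the product `F·G` at the integer exponent vector `w`, where `F` is a
polynomial and `G` a Laurent polynomial. -/
def mulCoeffZ {K : Type*} [Field K] {n : ℕ} (F : MvPolynomial (Fin (n + 1)) K)
    (G : (Fin (n + 1) → ℤ) →₀ K) (w : Fin (n + 1) → ℤ) : K :=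
  ∑ t ∈ F.support, MvPolynomial.coeff t F * G fun i => w i - (t i : ℤ)

theorem mem_Dfin {n ℓ : ℕ} {w : Fin (n + 1) → ℤ} :
    w ∈ Dfin n ℓ ↔ (∀ i, 0 ≤ w i) ∧ ∑ i, w i = (ℓ : ℤ) := by
  simp only [Dfin, Finset.mem_image, Finset.Nat.mem_antidiagonalTuple]
  constructor
  · rintro ⟨t, ht, rfl⟩
    exact ⟨fun i => Int.natCast_nonneg _, by simp [← ht]⟩
  · rintro ⟨h0, hs⟩
    refine ⟨fun i => (w i).toNat, ?_, funext fun i => Int.toNat_of_nonneg (h0 i)⟩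
    zify
    rw [← hs]
    exact Finset.sum_congr rfl fun i _ => Int.toNat_of_nonneg (h0 i)

theorem sub_mem_Dv {n ℓ : ℕ} {v w : Fin (n + 1) → ℤ} : v - w ∈ Dv v ℓ ↔ w ∈ Dfin n ℓ := by
  simp [Dv]

theorem restrictF_apply {K : Type*} [Field K] {n : ℕ} (G : (Fin (n + 1) → ℤ) →₀ K)
    (S : Finset (Fin (n + 1) → ℤ)) (u : Fin (n + 1) → ℤ) :
    restrictF G S u = if u ∈ S then G u else 0 := by
  classical
  simp [restrictF, Finsupp.finsetSum_apply, Finsupp.single_apply]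

theorem eqFun_apply {K : Type*} [Field K] {n : ℕ} (F : MvPolynomial (Fin (n + 1)) K) (d m : ℕ)
    (v s : Fin (n + 1) → ℤ) (i : Fin (n + 1)) (G : (Fin (n + 1) → ℤ) →₀ K) :
    eqFun F d m v s i G = ∑ t ∈ Dfin n d,
      ((((v i - s i : ℤ) : K) - ((m : K) + 1) * ((t i : ℤ) : K)) * coeffZ F t) *
        G (v - s - t) := by
  simp [eqFun]

theorem eqFun_add_add {K : Type*} [Field K] {n : ℕ} (F : MvPolynomial (Fin (n + 1)) K)
    (d m : ℕ) (v s e : Fin (n + 1) → ℤ) (i : Fin (n + 1)) :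
    eqFun F d m (v + e) (s + e) i = eqFun F d m v s i := by
  simp [eqFun]

theorem sum_eqFun {K : Type*} [Field K] {n : ℕ} (F : MvPolynomial (Fin (n + 1)) K) (d m : ℕ)
    (v s : Fin (n + 1) → ℤ) (h : ∑ i, (v i - s i) = (d : ℤ) * (m + 1))
    (G : (Fin (n + 1) → ℤ) →₀ K) : ∑ i, eqFun F d m v s i G = 0 := by
  simp only [eqFun_apply]
  rw [Finset.sum_comm]
  refine Finset.sum_eq_zero fun t ht => ?_
  rw [← Finset.sum_mul, ← Finset.sum_mul, Finset.sum_sub_distrib, ← Finset.mul_sum,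
    ← Int.cast_sum, ← Int.cast_sum, h, (mem_Dfin.1 ht).2]
  push_cast
  ring

theorem mem_Espace {K : Type*} [Field K] {n : ℕ} {F : MvPolynomial (Fin (n + 1)) K} {d m ℓ : ℕ}
    {v : Fin (n + 1) → ℤ} {G : (Fin (n + 1) → ℤ) →₀ K} :
    G ∈ Espace F d m v ℓ ↔ (∀ u, u ∉ Dv v ℓ → G u = 0) ∧
      ∀ s ∈ Dfin n (ℓ - d), ∀ i, eqFun F d m v s i G = 0 := by
  simp only [Espace, Submodule.mem_inf, Finsupp.mem_supported', Submodule.mem_iInf,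
    LinearMap.mem_ker, Finset.mem_coe]

/-- The exponent vector of total degree `L` on the edge opposite to vertex `i`, with entry `a`
at `i + 1`. -/
def edgePoint (i : Fin (2 + 1)) (L a : ℕ) : Fin (2 + 1) → ℤ :=
  fun l => if l = i then 0 else if l = i + 1 then (a : ℤ) else (L : ℤ) - a

theorem sum_fin_three_rotate {M : Type*} [AddCommMonoid M] (i : Fin (2 + 1))
    (f : Fin (2 + 1) → M) : ∑ l, f l = f i + f (i + 1) + f (i + 2) := by
  fin_cases i <;> simp [Fin.sum_univ_three] <;> abel

theorem prod_fin_three_rotate {M : Type*} [CommMonoid M] (i : Fin (2 + 1))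
    (f : Fin (2 + 1) → M) : ∏ l, f l = f i * f (i + 1) * f (i + 2) :=
  sum_fin_three_rotate (M := Additive M) i f

theorem fin_three_add_one_ne (i : Fin (2 + 1)) : i + 1 ≠ i := by
  revert i; decide

theorem fin_three_add_two_ne (i : Fin (2 + 1)) : i + 2 ≠ i := by
  revert i; decide

theorem fin_three_add_two_ne_add_one (i : Fin (2 + 1)) : i + 2 ≠ i + 1 := by
  revert i; decide

theorem eq_or_eq_add (i l : Fin (2 + 1)) : l = i ∨ l = i + 1 ∨ l = i + 2 := by
  revert i l; decide

@[simp] theorem edgePoint_self (i : Fin (2 + 1)) (L a : ℕ) : edgePoint i L a i = 0 := by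
  simp [edgePoint]

@[simp] theorem edgePoint_add_one (i : Fin (2 + 1)) (L a : ℕ) :
    edgePoint i L a (i + 1) = a := by
  simp [edgePoint]

@[simp] theorem edgePoint_add_two (i : Fin (2 + 1)) (L a : ℕ) :
    edgePoint i L a (i + 2) = (L : ℤ) - a := by
  simp only [edgePoint, if_neg (fin_three_add_two_ne i), if_neg (fin_three_add_two_ne_add_one i)]

theorem edgePoint_mem_Dfin (i : Fin (2 + 1)) {L a : ℕ} (h : a ≤ L) :
    edgePoint i L a ∈ Dfin 2 L := by
  refine mem_Dfin.2 ⟨fun l => ?_, ?_⟩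
  · rcases eq_or_eq_add i l with rfl | rfl | rfl <;> simp [h]
  · simp [sum_fin_three_rotate i]

theorem exists_eq_edgePoint {i : Fin (2 + 1)} {L : ℕ} {w : Fin (2 + 1) → ℤ}
    (hw : w ∈ Dfin 2 L) (hi : w i = 0) : ∃ a ≤ L, w = edgePoint i L a := by
  obtain ⟨h0, hs⟩ := mem_Dfin.1 hw
  rw [sum_fin_three_rotate i] at hs
  have h1 := h0 (i + 1)
  have h2 := h0 (i + 2)
  refine ⟨(w (i + 1)).toNat, by omega, funext fun l => ?_⟩
  rcases eq_or_eq_add i l with rfl | rfl | rfl <;> simp <;> omega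

theorem edgePoint_add_edgePoint (i : Fin (2 + 1)) (L M a b : ℕ) :
    edgePoint i L a + edgePoint i M b = edgePoint i (L + M) (a + b) := by
  funext l
  rcases eq_or_eq_add i l with rfl | rfl | rfl <;> simp
  ring

theorem sum_Dfin_two_eq_sum_range {M : Type*} [AddCommMonoid M] (i : Fin (2 + 1)) (L : ℕ)
    (f : (Fin (2 + 1) → ℤ) → M) (hf : ∀ t ∈ Dfin 2 L, t i ≠ 0 → f t = 0) :
    ∑ t ∈ Dfin 2 L, f t = ∑ a ∈ Finset.range (L + 1), f (edgePoint i L a) := by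
  classical
  rw [← Finset.sum_image (s := Finset.range (L + 1)) (g := edgePoint i L) (f := f)]
  · symm
    refine Finset.sum_subset ?_ ?_
    · intro t ht
      obtain ⟨a, ha, rfl⟩ := Finset.mem_image.1 ht
      exact edgePoint_mem_Dfin i (by simpa [Nat.lt_succ_iff] using ha)
    · intro t ht hn
      refine hf t ht fun h => hn ?_
      obtain ⟨a, ha, rfl⟩ := exists_eq_edgePoint ht h
      exact Finset.mem_image_of_mem _ (by simpa [Nat.lt_succ_iff] using ha)
  · intro a _ b _ h
    simpa using congrFun h (i + 1)

theorem coeff_X_mul_pderiv {R σ : Type*} [CommRing R] [DecidableEq σ] (l : σ)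
    (F : MvPolynomial σ R) (t : σ →₀ ℕ) :
    coeff t (X l * pderiv l F) = (t l : R) * coeff t F := by
  induction F using MvPolynomial.induction_on' with
  | monomial u a =>
    rw [X_mul_pderiv_monomial, coeff_smul, coeff_monomial]
    split_ifs with h <;> simp [h]
  | add p q hp hq => simp [hp, hq, mul_add]

theorem aeval_X_mul_pderiv {K A : Type*} [Field K] [CommRing A] [Algebra K A] {n d : ℕ}
    {F : MvPolynomial (Fin (n + 1)) K} (hF : F.IsHomogeneous d) (x : Fin (n + 1) → A)
    (l : Fin (n + 1)) :
    aeval x (X l * pderiv l F) = ∑ t ∈ Dfin n d,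
      algebraMap K A (((t l : ℤ) : K) * coeffZ F t) * ∏ j, x j ^ (t j).toNat := by
  classical
  have hsub : (X l * pderiv l F).support ⊆
      (Finset.Nat.antidiagonalTuple (n + 1) d).map
        (Finsupp.equivFunOnFinite : (Fin (n + 1) →₀ ℕ) ≃ _).symm.toEmbedding := by
    intro t ht
    rw [mem_support_iff, coeff_X_mul_pderiv] at ht
    have hdeg := hF (right_ne_zero_of_mul ht)
    refine Finset.mem_map.2 ⟨t, ?_, by ext; simp⟩
    rw [Finset.Nat.mem_antidiagonalTuple, ← hdeg, Finsupp.weight_apply,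
      Finsupp.sum_fintype _ _ (by simp)]
    simp
  rw [aeval_def, eval₂_eq', Finset.sum_subset hsub, Finset.sum_map, Dfin, Finset.sum_image]
  · refine Finset.sum_congr rfl fun t _ => ?_
    rw [coeff_X_mul_pderiv]
    simp [coeffZ]
  · intro a _ b _ h
    funext j
    simpa using congrFun h j
  · intro t _ ht
    rw [notMem_support_iff.1 ht]
    simp

theorem coeff_X_mul_derivative {R : Type*} [CommRing R] (p : Polynomial R) (a : ℕ) :
    (Polynomial.X * p.derivative).coeff a = (a : R) * p.coeff a := by
  cases a <;> simp [Polynomial.coeff_derivative, mul_comm]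

theorem natDegree_X_mul_derivative_le {R : Type*} [CommRing R] (p : Polynomial R) :
    (Polynomial.X * p.derivative).natDegree ≤ p.natDegree := by
  rw [Polynomial.natDegree_le_iff_coeff_eq_zero]
  intro a ha
  rw [coeff_X_mul_derivative, Polynomial.coeff_eq_zero_of_natDegree_lt ha, mul_zero]

section Edge

variable {K : Type*} [Field K]

/-- The restriction of a ternary form of degree `d` to the line `x_i = 0`, dehomogenized by
`x_{i+2} = 1`. -/
def edgePoly (F : MvPolynomial (Fin (2 + 1)) K) (d : ℕ) (i : Fin (2 + 1)) : Polynomial K :=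
  ∑ a ∈ Finset.range (d + 1), Polynomial.monomial a (coeffZ F (edgePoint i d a))

theorem coeff_edgePoly (F : MvPolynomial (Fin (2 + 1)) K) (d : ℕ) (i : Fin (2 + 1)) {a : ℕ}
    (ha : a ≤ d) : (edgePoly F d i).coeff a = coeffZ F (edgePoint i d a) := by
  simp only [edgePoly, Polynomial.finsetSum_coeff, Polynomial.coeff_monomial]
  rw [Finset.sum_ite_eq' , if_pos (by simpa [Nat.lt_succ_iff] using ha)]

theorem natDegree_edgePoly_le (F : MvPolynomial (Fin (2 + 1)) K) (d : ℕ) (i : Fin (2 + 1)) :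
    (edgePoly F d i).natDegree ≤ d :=
  Polynomial.natDegree_sum_le_of_forall_le _ _ fun a ha =>
    (Polynomial.natDegree_monomial_le _).trans (by simpa [Nat.lt_succ_iff] using ha)

theorem aeval_X_mul_pderiv_edge {A : Type*} [CommRing A] [Algebra K A] {d : ℕ}
    {F : MvPolynomial (Fin (2 + 1)) K} (hF : F.IsHomogeneous d) (i l : Fin (2 + 1))
    {x : Fin (2 + 1) → A} (hx : x i = 0) :
    aeval x (X l * pderiv l F) = ∑ a ∈ Finset.range (d + 1),
      algebraMap K A (((edgePoint i d a l : ℤ) : K) * (edgePoly F d i).coeff a) *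
        (x (i + 1) ^ a * x (i + 2) ^ (d - a)) := by
  rw [aeval_X_mul_pderiv hF, sum_Dfin_two_eq_sum_range i]
  · refine Finset.sum_congr rfl fun a ha => ?_
    have ha' : a ≤ d := by simpa [Nat.lt_succ_iff] using ha
    have : ((d : ℤ) - a).toNat = d - a := by omega
    rw [coeff_edgePoly F d i ha', prod_fin_three_rotate i]
    simp [this]
  · intro t ht hti
    have h0 := (mem_Dfin.1 ht).1 i
    rw [Finset.prod_eq_zero (Finset.mem_univ i), mul_zero]
    rw [hx, zero_pow]
    omega

variable {d : ℕ} {F : MvPolynomial (Fin (2 + 1)) K}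

theorem coeff_edgePoly_ne_zero (hF : F.IsHomogeneous d)
    (hnd : ∀ x : Fin (2 + 1) → AlgebraicClosure K,
      (∀ j, aeval x (X j * pderiv j F) = 0) → x = 0) (i : Fin (2 + 1)) :
    (edgePoly F d i).coeff d ≠ 0 := by
  intro h
  have hx := hnd (Pi.single (i + 1) 1) fun l => by
    rw [aeval_X_mul_pderiv_edge hF i l (Pi.single_eq_of_ne (fin_three_add_one_ne i).symm _)]
    refine Finset.sum_eq_zero fun a ha => ?_
    obtain rfl | hlt := (Nat.lt_succ_iff.1 (Finset.mem_range.1 ha)).eq_or_lt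
    · simp [h]
    · rw [Pi.single_eq_of_ne (fin_three_add_two_ne_add_one i), zero_pow (Nat.sub_ne_zero_of_lt hlt)]
      simp
  simpa using congrFun hx (i + 1)

theorem isCoprime_edgePoly (hF : F.IsHomogeneous d)
    (hnd : ∀ x : Fin (2 + 1) → AlgebraicClosure K,
      (∀ j, aeval x (X j * pderiv j F) = 0) → x = 0) (i : Fin (2 + 1)) :
    IsCoprime (edgePoly F d i) (Polynomial.X * (edgePoly F d i).derivative) := by
  rw [Polynomial.isCoprime_iff_aeval_ne_zero_of_isAlgClosed K (AlgebraicClosure K)]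
  intro y
  by_contra! hy
  obtain ⟨hp, hq⟩ := hy
  set p := edgePoly F d i with hpdef
  have hle : p.natDegree < d + 1 := Nat.lt_succ_of_le (natDegree_edgePoly_le F d i)
  have hqle : (Polynomial.X * p.derivative).natDegree < d + 1 :=
    (natDegree_X_mul_derivative_le p).trans_lt hle
  rw [Polynomial.aeval_eq_sum_range' hle] at hp
  rw [Polynomial.aeval_eq_sum_range' hqle] at hq
  simp only [coeff_X_mul_derivative] at hq
  let x : Fin (2 + 1) → AlgebraicClosure K := fun l => if l = i then 0 else
    if l = i + 1 then y else 1
  have hx0 : x i = 0 := by simp [x]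
  have hx1 : x (i + 1) = y := by simp [x]
  have hx2 : x (i + 2) = 1 := by 
    simp only [x, if_neg (fin_three_add_two_ne i), if_neg (fin_three_add_two_ne_add_one i)]
  have hx := hnd x fun l => by
    rw [aeval_X_mul_pderiv_edge hF i l hx0, hx1, hx2]
    rcases eq_or_eq_add i l with rfl | rfl | rfl
    · simp
    · rw [← hq]
      refine Finset.sum_congr rfl fun a _ => ?_
      simp [Algebra.smul_def, hpdef]
    · trans (d : AlgebraicClosure K) * ∑ a ∈ Finset.range (d + 1), p.coeff a • y ^ a
          - ∑ a ∈ Finset.range (d + 1), ((a : K) * p.coeff a) • y ^ a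
      · rw [Finset.mul_sum, ← Finset.sum_sub_distrib]
        refine Finset.sum_congr rfl fun a _ => ?_
        simp [Algebra.smul_def, hpdef]
        ring
      · rw [hp, hq]
        simp
  have := congrFun hx (i + 2)
  simp [hx2] at this

end Edge

section Sylvester

variable {K : Type*} [Field K] {p q : Polynomial K} {d : ℕ}

open Polynomial in
theorem exists_mul_add_mul_eq_of_degree_lt (hp : p.degree = d) (hq : q.degree ≤ d)
    (hpq : IsCoprime p q) {R : K[X]} (hR : R.degree < (d + d : ℕ)) :
    ∃ A B : K[X], A.degree < d ∧ B.degree < d ∧ A * p + B * q = R := by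
  obtain ⟨u, w, h⟩ := hpq
  have hp0 : p ≠ 0 := by rintro rfl; simp at hp
  have hmod : (R * w % p).degree < d := hp ▸ EuclideanDomain.mod_lt _ hp0
  have hsum : (R * u + R * w / p * q) * p + R * w % p * q = R := by
    have := EuclideanDomain.div_add_mod (R * w) p
    linear_combination R * h + q * this
  refine ⟨R * u + R * w / p * q, R * w % p, ?_, hmod, hsum⟩
  have hlt : ((R * u + R * w / p * q) * p).degree < (d + d : ℕ) := by
    rw [eq_sub_of_add_eq hsum]
    refine (degree_sub_le _ _).trans_lt (max_lt hR ?_)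
    by_cases hq0 : q = 0
    · rw [hq0, mul_zero, degree_zero]
      exact WithBot.bot_lt_coe _
    · rw [degree_mul]
      push_cast
      exact WithBot.add_lt_add_of_lt_of_le (by simpa using hq0) hmod hq
  rw [degree_mul, hp] at hlt
  push_cast at hlt
  exact lt_of_add_lt_add_right hlt

open Polynomial in
theorem eq_zero_of_sum_coeff_mul_eq_zero (hp : p.degree = d) (hq : q.degree ≤ d)
    (hpq : IsCoprime p q) {g : ℕ → K}
    (hgp : ∀ b < d, ∑ a ∈ Finset.range (d + 1), p.coeff a * g (a + b) = 0)
    (hgq : ∀ b < d, ∑ a ∈ Finset.range (d + 1), q.coeff a * g (a + b) = 0)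
    {k : ℕ} (hk : k < d + d) : g k = 0 := by
  let φ : K[X] →ₗ[K] K := Polynomial.lsum fun a => LinearMap.mulRight K (g a)
  have hφ (a : ℕ) (c : K) : φ (monomial a c) = c * g a := by
    simp [φ, Polynomial.lsum_apply, Polynomial.sum_monomial_index]
  have hvanish (r A : K[X]) (hr : r.degree ≤ d) (hA : A.degree < d)
      (h : ∀ b < d, ∑ a ∈ Finset.range (d + 1), r.coeff a * g (a + b) = 0) :
      φ (A * r) = 0 := by
    rcases eq_or_ne A 0 with rfl | hA0
    · simp
    have hA' : A.natDegree < d := (natDegree_lt_iff_degree_lt hA0).2 hA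
    rw [as_sum_range' A d hA', as_sum_range' r (d + 1)
      (Nat.lt_succ_of_le (natDegree_le_of_degree_le hr)), Finset.sum_mul, map_sum]
    refine Finset.sum_eq_zero fun b hb => ?_
    rw [Finset.mul_sum, map_sum]
    simp only [monomial_mul_monomial, hφ]
    rw [← mul_zero (A.coeff b), ← h b (Finset.mem_range.1 hb), Finset.mul_sum]
    exact Finset.sum_congr rfl fun a _ => by rw [add_comm b a]; ring
  obtain ⟨A, B, hA, hB, h⟩ := exists_mul_add_mul_eq_of_degree_lt (R := monomial k 1) hp hq hpq
    ((degree_monomial_le _ _).trans_lt (by exact_mod_cast hk))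
  have := hφ k 1
  rw [← h, map_add, hvanish p A hp.le hA hgp, hvanish q B hq hB hgq] at this
  simpa using this.symm

theorem exists_sum_coeff_mul_eq (hp : p.degree = d) (hq : q.degree ≤ d)
    (hpq : IsCoprime p q) (α β : ℕ → K) : ∃ g : ℕ → K, ∀ b < d,
      ∑ a ∈ Finset.range (d + 1), p.coeff a * g (a + b) = α b ∧
      ∑ a ∈ Finset.range (d + 1), q.coeff a * g (a + b) = β b := by
  let ext (n : ℕ) : (Fin (d + d) → K) →ₗ[K] K :=
    if h : n < d + d then LinearMap.proj ⟨n, h⟩ else 0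
  let T (r : Polynomial K) : (Fin (d + d) → K) →ₗ[K] (Fin d → K) :=
    LinearMap.pi fun b => ∑ a ∈ Finset.range (d + 1), r.coeff a • ext (a + b)
  have hT (r : Polynomial K) (g : Fin (d + d) → K) (b : Fin d) :
      T r g b = ∑ a ∈ Finset.range (d + 1), r.coeff a * ext (a + b) g := by
    simp [T]
  have hinj : Function.Injective ((T p).prod (T q)) := by
    rw [← LinearMap.ker_eq_bot, LinearMap.ker_eq_bot']
    intro g hg
    obtain ⟨h1, h2⟩ := Prod.ext_iff.1 hg
    funext k
    have := eq_zero_of_sum_coeff_mul_eq_zero (g := fun n => ext n g) hp hq hpq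
      (fun b hb => by simpa [hT] using congrFun h1 ⟨b, hb⟩)
      (fun b hb => by simpa [hT] using congrFun h2 ⟨b, hb⟩) k.2
    simpa [ext] using this
  obtain ⟨g, hg⟩ := (LinearMap.injective_iff_surjective_of_finrank_eq_finrank
    (by simp)).1 hinj (fun b => α b, fun b => β b)
  obtain ⟨h1, h2⟩ := Prod.ext_iff.1 hg
  exact ⟨fun n => ext n g, fun b hb =>
    ⟨by simpa [hT] using congrFun h1 ⟨b, hb⟩, by simpa [hT] using congrFun h2 ⟨b, hb⟩⟩⟩

end Sylvester

section EdgeSupported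

variable {K : Type*} [Field K]

/-- The Laurent polynomial with coefficients `g a` at the monomials `v - edgePoint i L a`. -/
def edgeLaurent (v : Fin (2 + 1) → ℤ) (i : Fin (2 + 1)) (L : ℕ) (g : ℕ → K) :
    (Fin (2 + 1) → ℤ) →₀ K :=
  ∑ a ∈ Finset.range (L + 1), Finsupp.single (v - edgePoint i L a) (g a)

theorem edgeLaurent_apply_edgePoint (v : Fin (2 + 1) → ℤ) (i : Fin (2 + 1)) {L a : ℕ}
    (g : ℕ → K) (ha : a ≤ L) : edgeLaurent v i L g (v - edgePoint i L a) = g a := by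
  rw [edgeLaurent, Finsupp.finsetSum_apply, Finset.sum_eq_single a]
  · simp
  · intro b _ hb
    refine Finsupp.single_eq_of_ne fun h => hb ?_
    have := congrFun h (i + 1)
    simp at this
    omega
  · intro h
    simp at h
    omega

theorem edgeLaurent_apply_of_ne (v : Fin (2 + 1) → ℤ) (i : Fin (2 + 1)) (L : ℕ)
    (g : ℕ → K) {u : Fin (2 + 1) → ℤ} (hu : u i ≠ v i) : edgeLaurent v i L g u = 0 := by
  rw [edgeLaurent, Finsupp.finsetSum_apply]
  refine Finset.sum_eq_zero fun a _ => Finsupp.single_eq_of_ne ?_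
  rintro rfl
  simp at hu

theorem edgeLaurent_apply_of_notMem (v : Fin (2 + 1) → ℤ) (i : Fin (2 + 1)) (L : ℕ)
    (g : ℕ → K) {u : Fin (2 + 1) → ℤ} (hu : u ∉ Dv v L) : edgeLaurent v i L g u = 0 := by
  rw [edgeLaurent, Finsupp.finsetSum_apply]
  refine Finset.sum_eq_zero fun a ha => Finsupp.single_eq_of_ne ?_
  rintro rfl
  exact hu (sub_mem_Dv.2 (edgePoint_mem_Dfin i (by simpa [Nat.lt_succ_iff] using ha)))

theorem eqFun_edgeLaurent_of_ne (F : MvPolynomial (Fin (2 + 1)) K) (d m : ℕ)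
    (v : Fin (2 + 1) → ℤ) (i l : Fin (2 + 1)) (L : ℕ) (g : ℕ → K) {s : Fin (2 + 1) → ℤ}
    (hs : 0 < s i) : eqFun F d m v s l (edgeLaurent v i L g) = 0 := by
  rw [eqFun_apply]
  refine Finset.sum_eq_zero fun t ht => ?_
  rw [edgeLaurent_apply_of_ne, mul_zero]
  have := (mem_Dfin.1 ht).1 i
  simp
  omega

theorem eqFun_edgeLaurent_edgePoint (F : MvPolynomial (Fin (2 + 1)) K) (d m : ℕ)
    (v : Fin (2 + 1) → ℤ) (i l : Fin (2 + 1)) (M b : ℕ) (hb : b ≤ M) (g : ℕ → K) :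
    eqFun F d m v (edgePoint i M b) l (edgeLaurent v i (M + d) g) =
      ∑ a ∈ Finset.range (d + 1),
        (((v l - edgePoint i M b l : ℤ) : K) - ((m : K) + 1) * ((edgePoint i d a l : ℤ) : K)) *
          ((edgePoly F d i).coeff a * g (a + b)) := by
  rw [eqFun_apply, sum_Dfin_two_eq_sum_range i]
  · refine Finset.sum_congr rfl fun a ha => ?_
    have ha' : a ≤ d := by simpa [Nat.lt_succ_iff] using ha
    rw [sub_sub, edgePoint_add_edgePoint, edgeLaurent_apply_edgePoint _ _ _ (by omega),
      coeff_edgePoly F d i ha', mul_assoc, add_comm b a]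
  · intro t ht hti
    rw [edgeLaurent_apply_of_ne, mul_zero]
    simpa using hti

theorem eqFun_edgeLaurent_self (F : MvPolynomial (Fin (2 + 1)) K) (d m : ℕ)
    (v : Fin (2 + 1) → ℤ) (i : Fin (2 + 1)) (M b : ℕ) (hb : b ≤ M) (g : ℕ → K) :
    eqFun F d m v (edgePoint i M b) i (edgeLaurent v i (M + d) g) =
      (v i : K) * ∑ a ∈ Finset.range (d + 1), (edgePoly F d i).coeff a * g (a + b) := by
  simp [eqFun_edgeLaurent_edgePoint F d m v i i M b hb g, Finset.mul_sum]

theorem eqFun_edgeLaurent_add_one (F : MvPolynomial (Fin (2 + 1)) K) (d m : ℕ)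
    (v : Fin (2 + 1) → ℤ) (i : Fin (2 + 1)) (M b : ℕ) (hb : b ≤ M) (g : ℕ → K) :
    eqFun F d m v (edgePoint i M b) (i + 1) (edgeLaurent v i (M + d) g) =
      ((v (i + 1) : K) - b) *
          ∑ a ∈ Finset.range (d + 1), (edgePoly F d i).coeff a * g (a + b) -
        ((m : K) + 1) * ∑ a ∈ Finset.range (d + 1),
          (Polynomial.X * (edgePoly F d i).derivative).coeff a * g (a + b) := by
  rw [eqFun_edgeLaurent_edgePoint F d m v i _ M b hb g, Finset.mul_sum, Finset.mul_sum,
    ← Finset.sum_sub_distrib]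
  refine Finset.sum_congr rfl fun a _ => ?_
  rw [coeff_X_mul_derivative]
  simp
  ring

theorem eq_edgeLaurent {v : Fin (2 + 1) → ℤ} {i : Fin (2 + 1)} {L : ℕ}
    {G : (Fin (2 + 1) → ℤ) →₀ K} (hsupp : ∀ u, u ∉ Dv v L → G u = 0)
    (hi : ∀ u ∈ Dv v L, u i ≠ v i → G u = 0) :
    G = edgeLaurent v i L fun a => G (v - edgePoint i L a) := by
  ext u
  by_cases hu : u ∈ Dv v L
  · by_cases hui : u i = v i
    · rw [← sub_sub_cancel v u, sub_mem_Dv] at hu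
      obtain ⟨a, ha, hw⟩ := exists_eq_edgePoint hu (i := i) (by simp [hui])
      rw [← sub_sub_cancel v u, hw, edgeLaurent_apply_edgePoint v i _ ha]
    · rw [hi u hu hui, edgeLaurent_apply_of_ne v i L _ hui]
  · rw [hsupp u hu, edgeLaurent_apply_of_notMem v i L _ hu]

end EdgeSupported

theorem mem_Dv_add_single_iff {n L : ℕ} {v u : Fin (n + 1) → ℤ} {i : Fin (n + 1)} :
    u ∈ Dv v L ↔ u ∈ Dv (v + Pi.single i 1) (L + 1) ∧
      u i ≠ (v + Pi.single i 1 : Fin (n + 1) → ℤ) i := by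
  rw [← sub_sub_cancel v u, sub_mem_Dv]
  have h : v - (v - u) = v + Pi.single i 1 - (v - u + Pi.single i 1) := by abel
  rw [h, sub_mem_Dv, mem_Dfin, mem_Dfin]
  simp only [Pi.add_apply, Pi.sub_apply, Pi.single_apply, Finset.sum_add_distrib,
    Finset.sum_ite_eq', Finset.mem_univ, if_true]
  push_cast
  constructor
  · rintro ⟨h0, h1⟩
    refine ⟨⟨fun j => ?_, by omega⟩, ?_⟩
    · have := h0 j
      split_ifs <;> omega
    · have := h0 i
      omega
  · rintro ⟨⟨h0, h1⟩, h2⟩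
    refine ⟨fun j => ?_, by omega⟩
    have := h0 j
    split_ifs at this with hj
    · subst hj
      omega
    · omega

theorem eqFun_restrictF {K : Type*} [Field K] {n : ℕ} (F : MvPolynomial (Fin (n + 1)) K)
    (d m k : ℕ) (v : Fin (n + 1) → ℤ) {s : Fin (n + 1) → ℤ} (hs : s ∈ Dfin n k)
    (i : Fin (n + 1)) (G : (Fin (n + 1) → ℤ) →₀ K) :
    eqFun F d m v s i (restrictF G (Dv v (k + d))) = eqFun F d m v s i G := by
  rw [eqFun_apply, eqFun_apply]
  refine Finset.sum_congr rfl fun t ht => ?_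
  rw [restrictF_apply, if_pos]
  rw [sub_sub, sub_mem_Dv, mem_Dfin]
  obtain ⟨hs0, hs1⟩ := mem_Dfin.1 hs
  obtain ⟨ht0, ht1⟩ := mem_Dfin.1 ht
  refine ⟨fun j => add_nonneg (hs0 j) (ht0 j), ?_⟩
  simp [Finset.sum_add_distrib, hs1, ht1]

theorem add_single_mem_Dfin {n k : ℕ} {s : Fin (n + 1) → ℤ} (hs : s ∈ Dfin n k)
    (i : Fin (n + 1)) : s + Pi.single i 1 ∈ Dfin n (k + 1) := by
  obtain ⟨h0, h1⟩ := mem_Dfin.1 hs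
  refine mem_Dfin.2 ⟨fun j => add_nonneg (h0 j) ?_, ?_⟩
  · rw [Pi.single_apply]
    split_ifs <;> simp
  · simp [Finset.sum_add_distrib, h1]

theorem sub_single_mem_Dfin {n k : ℕ} {s : Fin (n + 1) → ℤ} (hs : s ∈ Dfin n (k + 1))
    {i : Fin (n + 1)} (hi : 0 < s i) : s - Pi.single i 1 ∈ Dfin n k := by
  obtain ⟨h0, h1⟩ := mem_Dfin.1 hs
  refine mem_Dfin.2 ⟨fun j => ?_, ?_⟩
  · rcases eq_or_ne j i with rfl | hj
    · simpa using Int.add_one_le_of_lt hi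
    · simpa [hj] using h0 j
  · simp [Finset.sum_sub_distrib, h1]

/-- Remark 4.4: for `n = 2`, `ℓ = 2d - 2`, `F` nondegenerate, `d(m+1) ≠ 0` in `K`, `v` of
degree `dm + ℓ`, and `i` with `v_i + 1 ≠ 0` in `K`, the restriction map
`ℰ_{v+e_i,ℓ+1} → ℰ_{v,ℓ}`, `G̃ ↦ G̃|_{D(v,ℓ)}`, is a `K`-linear isomorphism; in
particular every `G ∈ ℰ_{v,ℓ}` extends uniquely to some `G̃ ∈ ℰ_{v+e_i,ℓ+1}`. -/
theorem restriction_bijective {K : Type*} [Field K]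
    (d : ℕ) (hd : 2 ≤ d) (hdK : (d : K) ≠ 0)
    (F : MvPolynomial (Fin (2 + 1)) K) (hF : F.IsHomogeneous d)
    (hnd : ∀ x : Fin (2 + 1) → AlgebraicClosure K,
      (∀ j, MvPolynomial.aeval x (X j * pderiv j F) = 0) → x = 0)
    (m : ℕ) (hm : (d : K) * ((m : K) + 1) ≠ 0)
    (v : Fin (2 + 1) → ℤ) (hv : (∑ j, v j) = ((d * m + (2 * d - 2) : ℕ) : ℤ))
    (i : Fin (2 + 1)) (hvi : ((v i + 1 : ℤ) : K) ≠ 0) :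
    (∀ Gt ∈ Espace F d m (v + Pi.single i 1) (2 * d - 1),
        restrictF Gt (Dv v (2 * d - 2)) ∈ Espace F d m v (2 * d - 2))
    ∧ (∀ G ∈ Espace F d m v (2 * d - 2),
        ∃! Gt : (Fin (2 + 1) → ℤ) →₀ K,
          Gt ∈ Espace F d m (v + Pi.single i 1) (2 * d - 1) ∧
            restrictF Gt (Dv v (2 * d - 2)) = G) := by
  obtain ⟨k, rfl⟩ : ∃ k, d = k + 2 := ⟨d - 2, by omega⟩
  have e1 : 2 * (k + 2) - 1 = (k + 1) + (k + 2) := by omega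
  have e2 : 2 * (k + 2) - 2 = k + (k + 2) := by omega
  rw [e2] at hv
  rw [e1, e2]
  set d := k + 2 with hd_def
  set v' : Fin (2 + 1) → ℤ := v + Pi.single i 1 with hv'
  set p := edgePoly F d i with hp_def
  have hm1 : (m : K) + 1 ≠ 0 := right_ne_zero_of_mul hm
  have hv'i : (v' i : K) ≠ 0 := by simpa [hv'] using hvi
  have hpdeg : p.degree = d := Polynomial.degree_eq_of_le_of_coeff_ne_zero
    (Polynomial.natDegree_le_iff_degree_le.1 (natDegree_edgePoly_le F d i))
    (coeff_edgePoly_ne_zero hF hnd i)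
  have hqdeg : (Polynomial.X * p.derivative).degree ≤ (d : WithBot ℕ) :=
    Polynomial.natDegree_le_iff_degree_le.1
      ((natDegree_X_mul_derivative_le p).trans (natDegree_edgePoly_le F d i))
  have hcop := isCoprime_edgePoly hF hnd i
  have hmemDv (u : Fin (2 + 1) → ℤ) :
      u ∈ Dv v (k + d) ↔ u ∈ Dv v' (k + 1 + d) ∧ u i ≠ v' i := by
    rw [mem_Dv_add_single_iff (i := i), add_right_comm]
  refine ⟨fun Gt hGt => ?_, fun G hG => ?_⟩
  · rw [mem_Espace, Nat.add_sub_cancel] at hGt ⊢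
    refine ⟨fun u hu => by rw [restrictF_apply, if_neg hu], fun s hs l => ?_⟩
    rw [eqFun_restrictF F d m k v hs, ← eqFun_add_add F d m v s (Pi.single i 1)]
    exact hGt.2 _ (add_single_mem_Dfin hs i) l
  have huniq : ∀ D ∈ Espace F d m v' (k + 1 + d), (∀ u ∈ Dv v (k + d), D u = 0) → D = 0 := by
    intro D hD hD0
    rw [mem_Espace, Nat.add_sub_cancel] at hD
    obtain ⟨hDsupp, hDeq⟩ := hD
    have hDedge := eq_edgeLaurent hDsupp fun u hu hui => hD0 u ((hmemDv u).2 ⟨hu, hui⟩)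
    generalize (fun a => D (v' - edgePoint i (k + 1 + d) a)) = g at hDedge
    subst hDedge
    have hgp : ∀ b < d, ∑ a ∈ Finset.range (d + 1), p.coeff a * g (a + b) = 0 := by
      intro b hb
      have h := hDeq _ (edgePoint_mem_Dfin i (show b ≤ k + 1 by omega)) i
      rw [eqFun_edgeLaurent_self F d m v' i _ b (by omega)] at h
      exact (mul_eq_zero.1 h).resolve_left hv'i
    have hgq : ∀ b < d, ∑ a ∈ Finset.range (d + 1),
        (Polynomial.X * p.derivative).coeff a * g (a + b) = 0 := by
      intro b hb
      have h := hDeq _ (edgePoint_mem_Dfin i (show b ≤ k + 1 by omega)) (i + 1)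
      rw [eqFun_edgeLaurent_add_one F d m v' i _ b (by omega), hgp b hb, mul_zero, zero_sub,
        neg_eq_zero] at h
      exact (mul_eq_zero.1 h).resolve_left hm1
    refine Finset.sum_eq_zero fun a ha => ?_
    have ha' : a < d + d := by
      have := Finset.mem_range.1 ha
      omega
    rw [eq_zero_of_sum_coeff_mul_eq_zero hpdeg hqdeg hcop hgp hgq ha', Finsupp.single_zero]
  suffices hex : ∃ Gt ∈ Espace F d m v' (k + 1 + d), restrictF Gt (Dv v (k + d)) = G by
    obtain ⟨Gt, hGt, hGtG⟩ := hex
    refine ⟨Gt, ⟨hGt, hGtG⟩, fun H hH => sub_eq_zero.1 ?_⟩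
    refine huniq _ (Submodule.sub_mem _ hH.1 hGt) fun u hu => ?_
    have h := DFunLike.congr_fun (hH.2.trans hGtG.symm) u
    rw [restrictF_apply, restrictF_apply, if_pos hu, if_pos hu] at h
    rw [Finsupp.sub_apply, h, sub_self]
  rw [mem_Espace, Nat.add_sub_cancel] at hG
  obtain ⟨hGsupp, hGeq⟩ := hG
  let P (b : ℕ) : K := -(v' i : K)⁻¹ * eqFun F d m v' (edgePoint i (k + 1) b) i G
  let Q (b : ℕ) : K := ((m : K) + 1)⁻¹ *
    (((v' (i + 1) : K) - b) * P b + eqFun F d m v' (edgePoint i (k + 1) b) (i + 1) G)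
  obtain ⟨g, hg⟩ := exists_sum_coeff_mul_eq hpdeg hqdeg hcop P Q
  refine ⟨G + edgeLaurent v' i (k + 1 + d) g, mem_Espace.2 ⟨fun u hu => ?_, ?_⟩, ?_⟩
  · rw [Finsupp.add_apply, hGsupp u fun h => hu ((hmemDv u).1 h).1,
      edgeLaurent_apply_of_notMem v' i _ g hu, add_zero]
  · rw [Nat.add_sub_cancel]
    intro s hs l
    rcases ((mem_Dfin.1 hs).1 i).eq_or_lt with hsi | hsi
    · obtain ⟨b, hb, rfl⟩ := exists_eq_edgePoint hs hsi.symm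
      obtain ⟨hgP, hgQ⟩ := hg b (by omega)
      have hself : eqFun F d m v' (edgePoint i (k + 1) b) i
          (G + edgeLaurent v' i (k + 1 + d) g) = 0 := by
        rw [map_add, eqFun_edgeLaurent_self F d m v' i _ b hb, hgP]
        simp only [P]
        field_simp
        ring
      have hadd_one : eqFun F d m v' (edgePoint i (k + 1) b) (i + 1)
          (G + edgeLaurent v' i (k + 1 + d) g) = 0 := by
        rw [map_add, eqFun_edgeLaurent_add_one F d m v' i _ b hb, hgP, hgQ]
        simp only [Q]
        field_simp
        ring
      have hsum := sum_eqFun F d m v' (edgePoint i (k + 1) b) (by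
        rw [Finset.sum_sub_distrib, (mem_Dfin.1 hs).2]
        simp only [hv', Pi.add_apply, Finset.sum_add_distrib, hv]
        simp
        ring) (G + edgeLaurent v' i (k + 1 + d) g)
      rw [sum_fin_three_rotate i, hself, hadd_one, zero_add, zero_add] at hsum
      rcases eq_or_eq_add i l with rfl | rfl | rfl
      exacts [hself, hadd_one, hsum]
    · rw [map_add, eqFun_edgeLaurent_of_ne F d m v' i l _ g hsi, add_zero,
        ← hGeq _ (sub_single_mem_Dfin hs hsi) l, ← eqFun_add_add F d m v _ (Pi.single i 1),
        sub_add_cancel]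
  · ext u
    rw [restrictF_apply]
    split_ifs with hu
    · rw [Finsupp.add_apply, edgeLaurent_apply_of_ne v' i _ g ((hmemDv u).1 hu).2, add_zero]
    · exact (hGsupp u hu).symm
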